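/- Let (X,d,m) be a PI space. Let Ω ⊆ X be an open, connected set of finite perimeter. Then Ω is indecomposable. -/

import Mathlib

open MeasureTheory Metric Filter Set
open scoped ENNReal NNReal Topology

namespace PaperBV

noncomputable section

variable {X : Type*} [MetricSpace X]

/-- `f` is locally Lipschitz on `Ω`. -/
def LocLipOn (Ω : Set X) (f : X → ℝ) : Prop :=
  ∀ x ∈ Ω, ∃ K : ℝ≥0, ∃ t ∈ 𝓝[Ω] x, LipschitzOnWith K f t

/-- The local Lipschitz constant (slope) `lip f` of a function, with value `0` at
points that are not accumulation points (there the filter `𝓝[≠] x` is trivial). -/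
def lipConst (f : X → ℝ) (x : X) : ℝ≥0∞ :=
  Filter.limsup (fun y => ENNReal.ofReal (|f y - f x| / dist y x)) (𝓝[≠] x)

variable [MeasurableSpace X]

/-- Convergence `fn → f` in `L¹_loc(μ⌊Ω)`. -/
def TendstoL1loc (μ : Measure X) (Ω : Set X) (fn : ℕ → X → ℝ) (f : X → ℝ) : Prop :=
  ∀ K : Set X, IsCompact K → K ⊆ Ω →
    Filter.Tendsto (fun n => ∫⁻ x in K, ENNReal.ofReal |fn n x - f x| ∂μ)
      Filter.atTop (𝓝 0)

/-- The total variation `|Df|(Ω)` of `f` on an open set `Ω`, defined by relaxation of the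
integral of the local Lipschitz constant along locally Lipschitz approximations. -/
def tvOpen (μ : Measure X) (f : X → ℝ) (Ω : Set X) : ℝ≥0∞ :=
  sInf { a : ℝ≥0∞ | ∃ fn : ℕ → X → ℝ, (∀ n, LocLipOn Ω (fn n)) ∧ TendstoL1loc μ Ω fn f ∧
    a = Filter.liminf (fun n => ∫⁻ x in Ω, lipConst (fn n) x ∂μ) Filter.atTop }

/-- The total variation measure `|Df|(B)` of `f` on an arbitrary set, obtained from the
values on open sets by the Carathéodory construction. -/
def tv (μ : Measure X) (f : X → ℝ) (B : Set X) : ℝ≥0∞ :=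
  ⨅ (Ω : Set X) (_ : IsOpen Ω) (_ : B ⊆ Ω), tvOpen μ f Ω

/-- `f` is a function of bounded variation: `f ∈ L¹(μ)` and `|Df|(X) < ∞`. -/
def BVFun (μ : Measure X) (f : X → ℝ) : Prop :=
  MeasureTheory.Integrable f μ ∧ tv μ f Set.univ < ⊤

/-- The perimeter `P(E, B) = |D 1_E|(B)`. -/
def perim (μ : Measure X) (E B : Set X) : ℝ≥0∞ :=
  tv μ (E.indicator fun _ => (1 : ℝ)) B

/-- `E` is a (Borel) set of finite perimeter. -/
def FinPerim (μ : Measure X) (E : Set X) : Prop :=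
  MeasurableSet E ∧ perim μ E Set.univ < ⊤

/-- `μ` is a doubling measure with doubling constant `CD`. -/
def Doubling (μ : Measure X) (CD : ℝ≥0) : Prop :=
  1 ≤ CD ∧ ∀ (x : X) (r : ℝ), 0 < r → μ (ball x (2 * r)) ≤ (CD : ℝ≥0∞) * μ (ball x r)

/-- The mean value `f_{x,r}` of `f` on the ball `B_r(x)`. -/
def ballAvg (μ : Measure X) (f : X → ℝ) (x : X) (r : ℝ) : ℝ :=
  (∫ y in ball x r, f y ∂μ) / (μ (ball x r)).toReal

/-- The weak `(1,1)`-Poincaré inequality with constants `CP`, `lam`,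
for locally Lipschitz functions. -/
def WeakPoincare (μ : Measure X) (CP lam : ℝ) : Prop :=
  ∀ f : X → ℝ, LocLipOn Set.univ f → ∀ (x : X) (r : ℝ), 0 < r →
    ∫⁻ y in ball x r, ENNReal.ofReal |f y - ballAvg μ f x r| ∂μ ≤
      ENNReal.ofReal (CP * r) * ∫⁻ y in ball x (lam * r), lipConst f y ∂μ

/-- A PI space: doubling and supporting a weak `(1,1)`-Poincaré inequality. -/
def IsPI (μ : Measure X) : Prop :=
  ∃ (CD : ℝ≥0) (CP lam : ℝ), Doubling μ CD ∧ 0 < CP ∧ 1 ≤ lam ∧ WeakPoincare μ CP lam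

/-- The pre-measure `H_δ` of the codimension-one Hausdorff measure: infimum over countable
covers by balls of radii at most `δ` of `∑ μ(B_{r_i}(x_i)) / (2 r_i)`. -/
def preH (μ : Measure X) (δ : ℝ) (S : Set X) : ℝ≥0∞ :=
  ⨅ (c : ℕ → X × ℝ) (_ : ∀ i, 0 < (c i).2 ∧ (c i).2 ≤ δ)
    (_ : S ⊆ ⋃ i, ball (c i).1 (c i).2),
    ∑' i, μ (ball (c i).1 (c i).2) / ENNReal.ofReal (2 * (c i).2)

/-- The codimension-one Hausdorff measure `H = lim_{δ ↓ 0} H_δ = sup_{δ > 0} H_δ`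
(as an outer-measure-type set function). -/
def codimH (μ : Measure X) (S : Set X) : ℝ≥0∞ :=
  ⨆ (δ : ℝ) (_ : 0 < δ), preH μ δ S

/-- The upper density of `E` at `x`. -/
def upperDens (μ : Measure X) (E : Set X) (x : X) : ℝ≥0∞ :=
  Filter.limsup (fun r : ℝ => μ (E ∩ ball x r) / μ (ball x r)) (𝓝[>] (0 : ℝ))

/-- The essential boundary `∂^e E`. -/
def essBdry (μ : Measure X) (E : Set X) : Set X :=
  {x | 0 < upperDens μ E x ∧ 0 < upperDens μ Eᶜ x}

/-- The essential interior `E^1`: points of density `1`. -/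
def essInt (μ : Measure X) (E : Set X) : Set X :=
  {x | Filter.Tendsto (fun r : ℝ => μ (E ∩ ball x r) / μ (ball x r))
    (𝓝[>] (0 : ℝ)) (𝓝 (1 : ℝ≥0∞))}

/-- Integral `∫_S f dν` with respect to an outer-measure-type set function `ν`,
via the layer-cake formula. -/
def outerLint (ν : Set X → ℝ≥0∞) (S : Set X) (f : X → ℝ≥0∞) : ℝ≥0∞ :=
  ∫⁻ t in Set.Ioi (0 : ℝ), ν {x ∈ S | ENNReal.ofReal t < f x}

/-- `θ` is a family of densities representing the perimeter measures with respect to the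
codimension-one Hausdorff measure: `P(E,B) = ∫_{B ∩ ∂^e E} θ_E dH`, with
`γ ≤ θ_E ≤ C` on `∂^e E` for structural constants `0 < γ`, `C < ∞`. -/
def PerimRepr (μ : Measure X) (θ : Set X → X → ℝ≥0∞) : Prop :=
  ∃ γ C : ℝ≥0∞, 0 < γ ∧ C ≠ ⊤ ∧
    ∀ E : Set X, FinPerim μ E →
      (∀ x ∈ essBdry μ E, γ ≤ θ E x ∧ θ E x ≤ C) ∧
      ∀ B : Set X, MeasurableSet B →
        perim μ E B = outerLint (codimH μ) (B ∩ essBdry μ E) (θ E)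

/-- The space is isotropic: the densities `θ_E` can be chosen so that, whenever `F ⊆ E` are
sets of finite perimeter, `θ_F = θ_E` holds `H`-a.e. on `∂^e F ∩ ∂^e E`. -/
def Isotropic (μ : Measure X) : Prop :=
  ∃ θ : Set X → X → ℝ≥0∞, PerimRepr μ θ ∧
    ∀ E F : Set X, FinPerim μ E → FinPerim μ F → F ⊆ E →
      codimH μ {x ∈ essBdry μ F ∩ essBdry μ E | θ F x ≠ θ E x} = 0

/-- Property (1.2): `H(∂^e E ∩ ∂^e F ∩ ∂^e (E ∪ F)) = 0` for disjoint sets of finite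
perimeter. -/
def Prop12 (μ : Measure X) : Prop :=
  ∀ E F : Set X, FinPerim μ E → FinPerim μ F → Disjoint E F →
    codimH μ (essBdry μ E ∩ essBdry μ F ∩ essBdry μ (E ∪ F)) = 0

/-- `E` is decomposable in `B`: `E ∩ B` admits a partition into two sets of finite perimeter
and positive measure such that the perimeter in `B` is additive. -/
def DecomposableIn (μ : Measure X) (E B : Set X) : Prop :=
  ∃ F G : Set X, FinPerim μ F ∧ FinPerim μ G ∧ Disjoint F G ∧ F ∪ G = E ∩ B ∧
    0 < μ F ∧ 0 < μ G ∧ perim μ E B = perim μ F B + perim μ G B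

/-- `E` is a set of finite perimeter which is indecomposable in `B`. -/
def IndecomposableIn (μ : Measure X) (E B : Set X) : Prop :=
  FinPerim μ E ∧ ¬ DecomposableIn μ E B

/-- `E` is an indecomposable set (of finite perimeter). -/
def Indecomposable (μ : Measure X) (E : Set X) : Prop :=
  IndecomposableIn μ E Set.univ

/-- `E` is a simple set. -/
def SimpleSet (μ : Measure X) (E : Set X) : Prop :=
  FinPerim μ E ∧ μ E < ⊤ ∧
  ∀ F : Set X, FinPerim μ F → codimH μ (essBdry μ F \ essBdry μ E) = 0 →
    μ F = 0 ∨ μ Fᶜ = 0 ∨ μ (symmDiff F E) = 0 ∨ μ (symmDiff F Eᶜ) = 0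

end

section LipConst

variable {X : Type*} [MetricSpace X]

theorem ennreal_limsup_add_le {α : Type*} (l : Filter α) (u v : α → ℝ≥0∞) :
    limsup (fun y => u y + v y) l ≤ limsup u l + limsup v l := by
  refine ENNReal.le_of_forall_pos_le_add fun ε hε hlt => ?_
  have hε' : (0 : ℝ≥0∞) < (ε : ℝ≥0∞) / 2 := by
    simpa using (ENNReal.coe_pos.2 hε).ne'
  obtain ⟨hu, hv⟩ := ENNReal.add_lt_top.1 hlt
  have h₁ := eventually_lt_of_limsup_lt (ENNReal.lt_add_right hu.ne hε'.ne')
  have h₂ := eventually_lt_of_limsup_lt (ENNReal.lt_add_right hv.ne hε'.ne')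
  refine limsup_le_of_le (by isBoundedDefault) ?_
  filter_upwards [h₁, h₂] with y h₁ h₂
  calc u y + v y ≤ (limsup u l + ε / 2) + (limsup v l + ε / 2) := add_le_add h₁.le h₂.le
    _ = limsup u l + limsup v l + (ε / 2 + ε / 2) := by ring
    _ = limsup u l + limsup v l + ε := by rw [ENNReal.add_halves]

theorem ennreal_liminf_add_le_liminf_add {α : Type*} (l : Filter α) (u v : α → ℝ≥0∞) :
    liminf u l + liminf v l ≤ liminf (fun y => u y + v y) l := by
  simp only [liminf_eq_iSup_iInf]
  refine ENNReal.biSup_add_biSup_le' ⟨univ, univ_mem⟩ ⟨univ, univ_mem⟩ fun s hs t ht => ?_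
  refine le_trans ?_ (le_iSup₂_of_le (s ∩ t) (inter_mem hs ht) le_rfl)
  exact le_iInf₂ fun y hy => add_le_add (iInf₂_le y hy.1) (iInf₂_le y hy.2)

theorem lipConst_add_le (f g : X → ℝ) (x : X) :
    lipConst (fun y => f y + g y) x ≤ lipConst f x + lipConst g x := by
  refine le_trans (limsup_le_limsup (Eventually.of_forall fun y => ?_))
    (ennreal_limsup_add_le _ _ _)
  dsimp only
  rw [← ENNReal.ofReal_add (by positivity) (by positivity), ← add_div]
  refine ENNReal.ofReal_le_ofReal (div_le_div_of_nonneg_right ?_ dist_nonneg)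
  have : f y + g y - (f x + g x) = (f y - f x) + (g y - g x) := by ring
  rw [this]
  exact abs_add_le _ _

theorem lipConst_congr {f g : X → ℝ} {x : X} (h : f =ᶠ[𝓝 x] g) :
    lipConst f x = lipConst g x := by
  refine limsup_congr ?_
  filter_upwards [h.filter_mono nhdsWithin_le_nhds] with y hy
  rw [hy, h.self_of_nhds]

theorem lipConst_const (c : ℝ) (x : X) : lipConst (fun _ : X => c) x = 0 := by
  simp only [lipConst, sub_self, abs_zero, zero_div, ENNReal.ofReal_zero]
  exact le_antisymm (limsup_le_of_le (by isBoundedDefault) (Eventually.of_forall fun _ => le_rfl))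
    zero_le

/-- Leibniz estimate for the slope of a product with a Lipschitz cutoff. -/
theorem lipConst_const_add_mul_le {φ u : X → ℝ} {C : ℝ≥0} (hφ : LipschitzWith C φ)
    (h0 : ∀ y, 0 ≤ φ y) (h1 : ∀ y, φ y ≤ 1) (x : X) :
    lipConst (fun y => 1 + φ y * (u y - 1)) x ≤
      lipConst u x + C * ENNReal.ofReal |u x - 1| := by
  have hconst : limsup (fun _ : X => (C : ℝ≥0∞) * ENNReal.ofReal |u x - 1|) (𝓝[≠] x) ≤
      C * ENNReal.ofReal |u x - 1| :=
    limsup_le_of_le (by isBoundedDefault) (Eventually.of_forall fun _ => le_rfl)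
  refine le_trans (limsup_le_limsup ?_) ((ennreal_limsup_add_le _ _ _).trans
    (add_le_add le_rfl hconst))
  filter_upwards [self_mem_nhdsWithin] with y hy
  have hd : 0 < dist y x := dist_pos.2 hy
  have hC : (C : ℝ≥0∞) = ENNReal.ofReal C := by simp
  rw [hC, ← ENNReal.ofReal_mul C.coe_nonneg, ← ENNReal.ofReal_add (by positivity) (by positivity)]
  refine ENNReal.ofReal_le_ofReal ?_
  rw [div_le_iff₀ hd, add_mul, div_mul_cancel₀ _ hd.ne']
  have e : 1 + φ y * (u y - 1) - (1 + φ x * (u x - 1)) =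
      φ y * (u y - u x) + (u x - 1) * (φ y - φ x) := by ring
  rw [e]
  refine (abs_add_le _ _).trans (add_le_add ?_ ?_)
  · rw [abs_mul, abs_of_nonneg (h0 y)]
    exact mul_le_of_le_one_left (abs_nonneg _) (h1 y)
  · rw [abs_mul]
    have := hφ.dist_le_mul y x
    rw [Real.dist_eq] at this
    nlinarith [abs_nonneg (u x - 1)]

theorem LocLipOn.mono {U V : Set X} {f : X → ℝ} (h : LocLipOn V f) (hUV : U ⊆ V) :
    LocLipOn U f := fun x hx => by
  obtain ⟨K, t, ht, hK⟩ := h x (hUV hx)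
  exact ⟨K, t, nhdsWithin_mono x hUV ht, hK⟩

theorem LocLipOn.exists_nhds {V : Set X} {f : X → ℝ} (h : LocLipOn V f) (hV : IsOpen V)
    {x : X} (hx : x ∈ V) : ∃ K : ℝ≥0, ∃ t ∈ 𝓝 x, LipschitzOnWith K f t := by
  obtain ⟨K, t, ht, hK⟩ := h x hx
  exact ⟨K, t, by rwa [hV.nhdsWithin_eq hx] at ht, hK⟩

theorem LocLipOn.continuousAt {V : Set X} {f : X → ℝ} (h : LocLipOn V f) (hV : IsOpen V)
    {x : X} (hx : x ∈ V) : ContinuousAt f x := by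
  obtain ⟨K, t, ht, hK⟩ := h.exists_nhds hV hx
  exact hK.continuousOn.continuousAt ht

theorem LocLipOn.add {V : Set X} {f g : X → ℝ} (hf : LocLipOn V f) (hg : LocLipOn V g) :
    LocLipOn V (fun y => f y + g y) := fun x hx => by
  obtain ⟨K, t, ht, hK⟩ := hf x hx
  obtain ⟨K', t', ht', hK'⟩ := hg x hx
  exact ⟨K + K', t ∩ t', inter_mem ht ht',
    (hK.mono inter_subset_left).add (hK'.mono inter_subset_right)⟩

theorem locLipOn_const (V : Set X) (c : ℝ) : LocLipOn V (fun _ => c) := fun _ _ =>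
  ⟨0, univ, univ_mem, (LipschitzWith.const c).lipschitzOnWith⟩

/-- A locally Lipschitz function on `V`, multiplied by a Lipschitz cutoff vanishing on an open set
`W` with `V ∪ W = univ`, is locally Lipschitz. -/
theorem LocLipOn.cutoff_mul {V W : Set X} {φ u : X → ℝ} {C : ℝ≥0} (hu : LocLipOn V u)
    (hV : IsOpen V) (hW : IsOpen W) (hVW : ∀ y, y ∈ V ∨ y ∈ W) (hφ : LipschitzWith C φ)
    (h0 : ∀ y, 0 ≤ φ y) (h1 : ∀ y, φ y ≤ 1) (hφW : ∀ y ∈ W, φ y = 0) :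
    LocLipOn univ (fun y => φ y * u y) := fun x _ => by
  rw [nhdsWithin_univ]
  rcases hVW x with hx | hx
  · obtain ⟨K, t, ht, hK⟩ := hu.exists_nhds hV hx
    have hbd : ∀ᶠ y in 𝓝 x, |u y| < |u x| + 1 :=
      (hu.continuousAt hV hx).abs.eventually_lt_const (lt_add_one _)
    refine ⟨K + (|u x| + 1).toNNReal * C, t ∩ {y | |u y| < |u x| + 1},
      inter_mem ht hbd, LipschitzOnWith.of_dist_le_mul fun y hy z hz => ?_⟩
    have h₁ := hK.dist_le_mul y hy.1 z hz.1
    have h₂ := hφ.dist_le_mul y z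
    have h₃ : |u z| < |u x| + 1 := hz.2
    rw [Real.dist_eq] at *
    have e : φ y * u y - φ z * u z = φ y * (u y - u z) + u z * (φ y - φ z) := by ring
    rw [e]
    rw [NNReal.coe_add, NNReal.coe_mul, Real.coe_toNNReal _ (by positivity), add_mul, mul_assoc]
    refine (abs_add_le _ _).trans (add_le_add ?_ ?_)
    · rw [abs_mul, abs_of_nonneg (h0 y)]
      exact (mul_le_of_le_one_left (abs_nonneg _) (h1 y)).trans h₁
    · rw [abs_mul]
      exact mul_le_mul h₃.le h₂ (abs_nonneg _) (by positivity)
  · refine ⟨0, W, hW.mem_nhds hx, LipschitzOnWith.of_dist_le_mul fun y hy z hz => ?_⟩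
    simp [hφW y hy, hφW z hz]

theorem exists_radial_cutoff (x : X) {a b : ℝ} (hab : a < b) :
    ∃ (C : ℝ≥0) (φ : X → ℝ), LipschitzWith C φ ∧ (∀ y, 0 ≤ φ y) ∧ (∀ y, φ y ≤ 1) ∧
      (∀ y, dist y x ≤ a → φ y = 0) ∧ (∀ y, b ≤ dist y x → φ y = 1) := by
  have hba : 0 < b - a := sub_pos.2 hab
  refine ⟨⟨(b - a)⁻¹, by positivity⟩, fun y => max 0 (min 1 ((b - a)⁻¹ * (dist y x - a))),
    ?_, fun y => le_max_left _ _, fun y => max_le zero_le_one (min_le_left _ _),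
    fun y hy => ?_, fun y hy => ?_⟩
  · refine LipschitzWith.const_max (LipschitzWith.const_min (LipschitzWith.of_dist_le_mul
      fun y z => ?_) 1) 0
    rw [Real.dist_eq, ← mul_sub, abs_mul, abs_of_pos (inv_pos.2 hba)]
    refine mul_le_mul_of_nonneg_left ?_ (by positivity)
    rw [sub_sub_sub_cancel_right]
    exact abs_dist_sub_le y z x
  · have : (b - a)⁻¹ * (dist y x - a) ≤ 0 :=
      mul_nonpos_of_nonneg_of_nonpos (by positivity) (by linarith)
    exact max_eq_left ((min_le_right _ _).trans this)
  · have : 1 ≤ (b - a)⁻¹ * (dist y x - a) := by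
      rw [← div_eq_inv_mul, le_div_iff₀ hba]; linarith
    simp [this]

variable [MeasurableSpace X] [BorelSpace X]

theorem aemeasurable_of_isOpen_superlevel {V : Set X} (hV : IsOpen V) {h : X → ℝ≥0∞}
    (hh : ∀ a, IsOpen {x ∈ V | a < h x}) (μ : Measure X) : AEMeasurable h (μ.restrict V) := by
  refine (aemeasurable_indicator_iff hV.measurableSet).1 (Measurable.aemeasurable ?_)
  refine measurable_of_Ioi fun a => ?_
  convert (hh a).measurableSet using 1
  ext x
  by_cases hx : x ∈ V <;> simp [hx]

theorem LocLipOn.aemeasurable_lipConst {V : Set X} {f : X → ℝ} (hf : LocLipOn V f)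
    (hV : IsOpen V) (μ : Measure X) : AEMeasurable (lipConst f) (μ.restrict V) := by
  have e : lipConst f = fun x => ⨅ n : ℕ, ⨆ y ∈ ball x (1 / ((n : ℝ) + 1)) ∩ {x}ᶜ,
      ENNReal.ofReal (|f y - f x| / dist y x) := by
    ext x
    rw [lipConst, (nhdsWithin_hasBasis nhds_basis_ball_inv_nat_succ {x}ᶜ).limsup_eq_iInf_iSup]
    simp
  rw [e]
  refine AEMeasurable.iInf fun n => aemeasurable_of_isOpen_superlevel hV (fun a => ?_) μ
  rw [isOpen_iff_mem_nhds]
  rintro x ⟨hx, hax⟩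
  simp only [lt_iSup_iff] at hax
  obtain ⟨y, ⟨hy, hyx⟩, hay⟩ := hax
  have hne : y ≠ x := hyx
  have hcont : ContinuousAt (fun z => ENNReal.ofReal (|f y - f z| / dist y z)) x := by
    refine ENNReal.continuous_ofReal.continuousAt.comp ?_
    exact ((continuousAt_const.sub (hf.continuousAt hV hx)).abs).div
      (continuousAt_const.dist continuousAt_id) (dist_pos.2 hne).ne'
  filter_upwards [hV.mem_nhds hx, hcont.eventually_const_lt hay,
    (continuous_const.dist continuous_id).continuousAt.eventually_lt_const (mem_ball.1 hy),
    (continuousAt_id.eventually_ne hne.symm)] with z hzV hz hzd hzy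
  refine ⟨hzV, ?_⟩
  simp only [lt_iSup_iff]
  exact ⟨y, ⟨mem_ball.2 hzd, fun h => hzy (by simpa using h.symm)⟩, hz⟩

theorem LocLipOn.aemeasurable {V : Set X} {f : X → ℝ} (hf : LocLipOn V f)
    (hV : IsOpen V) (μ : Measure X) : AEMeasurable f (μ.restrict V) :=
  ContinuousOn.aemeasurable (fun _ hx => (hf.continuousAt hV hx).continuousWithinAt)
    hV.measurableSet

end LipConst

section TotalVariation

variable {X : Type*} [MetricSpace X] [MeasurableSpace X]

theorem tv_univ (μ : Measure X) (f : X → ℝ) : tv μ f univ = tvOpen μ f univ := by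
  refine le_antisymm (iInf₂_le_of_le univ isOpen_univ (iInf_le _ Subset.rfl)) ?_
  refine le_iInf fun U => le_iInf fun _ => le_iInf fun hU => ?_
  rw [univ_subset_iff.1 hU]

/-- Almost optimal approximations can be chosen with all energies below the given bound. -/
theorem exists_seq_of_tvOpen_lt {μ : Measure X} {f : X → ℝ} {U : Set X} {a : ℝ≥0∞}
    (h : tvOpen μ f U < a) : ∃ fn : ℕ → X → ℝ, (∀ n, LocLipOn U (fn n)) ∧
      TendstoL1loc μ U fn f ∧ ∀ n, ∫⁻ x in U, lipConst (fn n) x ∂μ < a := by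
  obtain ⟨_, ⟨fn, hlip, htend, rfl⟩, hlt⟩ := sInf_lt_iff.1 h
  obtain ⟨k, hk, hka⟩ := extraction_of_frequently_atTop
    (frequently_lt_of_liminf_lt (by isBoundedDefault) hlt)
  exact ⟨fun n => fn (k n), fun n => hlip _,
    fun K hK hKU => (htend K hK hKU).comp hk.tendsto_atTop, hka⟩

theorem tvOpen_le_of_seq {μ : Measure X} {f : X → ℝ} {U : Set X} {a : ℝ≥0∞} {fn : ℕ → X → ℝ}
    (hlip : ∀ n, LocLipOn U (fn n)) (htend : TendstoL1loc μ U fn f)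
    (h : ∀ n, ∫⁻ x in U, lipConst (fn n) x ∂μ ≤ a) : tvOpen μ f U ≤ a := by
  refine (sInf_le ⟨fn, hlip, htend, rfl⟩ : tvOpen μ f U ≤ _).trans ?_
  exact (liminf_le_liminf (Eventually.of_forall h)).trans (liminf_const a).le

theorem tvOpen_add_tvOpen_le [BorelSpace X] {μ : Measure X} {f : X → ℝ} {U V : Set X}
    (hV : IsOpen V) (hUV : Disjoint U V) :
    tvOpen μ f U + tvOpen μ f V ≤ tvOpen μ f univ := by
  refine le_of_forall_gt fun a ha => ?_
  obtain ⟨b, hb, hba⟩ := exists_between ha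
  obtain ⟨fn, hlip, htend, hlt⟩ := exists_seq_of_tvOpen_lt hb
  have hU := (sInf_le ⟨fn, fun n => (hlip n).mono (subset_univ U),
    fun K hK _ => htend K hK (subset_univ K), rfl⟩ : tvOpen μ f U ≤ _)
  have hV' := (sInf_le ⟨fn, fun n => (hlip n).mono (subset_univ V),
    fun K hK _ => htend K hK (subset_univ K), rfl⟩ : tvOpen μ f V ≤ _)
  refine lt_of_le_of_lt ((add_le_add hU hV').trans (ennreal_liminf_add_le_liminf_add _ _ _ |>.trans ?_)) hba
  refine (liminf_le_liminf (Eventually.of_forall fun n => ?_)).trans (liminf_const b).le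
  rw [← lintegral_union hV.measurableSet hUV]
  exact (lintegral_mono_set (subset_univ _)).trans (hlt n).le

theorem tvOpen_add_le [BorelSpace X] {μ : Measure X} {f g : X → ℝ} (hf : Measurable f)
    {V : Set X} (hV : IsOpen V) :
    tvOpen μ (fun x => f x + g x) V ≤ tvOpen μ f V + tvOpen μ g V := by
  refine ENNReal.le_of_forall_pos_le_add fun ε hε hlt => ?_
  have hε' : ((ε : ℝ≥0∞) / 2) ≠ 0 := by simpa using hε.ne'
  obtain ⟨hF, hG⟩ := ENNReal.add_lt_top.1 hlt
  obtain ⟨fn, hfl, hft, hfa⟩ := exists_seq_of_tvOpen_lt (ENNReal.lt_add_right hF.ne hε')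
  obtain ⟨gn, hgl, hgt, hga⟩ := exists_seq_of_tvOpen_lt (ENNReal.lt_add_right hG.ne hε')
  refine tvOpen_le_of_seq (fn := fun n x => fn n x + gn n x) (fun n => (hfl n).add (hgl n))
    (fun K hK hKV => ?_) (fun n => ?_)
  · refine tendsto_of_tendsto_of_tendsto_of_le_of_le tendsto_const_nhds
      (by simpa using (hft K hK hKV).add (hgt K hK hKV)) (fun n => zero_le) (fun n => ?_)
    have hm : AEMeasurable (fun x => ENNReal.ofReal |fn n x - f x|) (μ.restrict K) := by
      have h := ((hfl n).aemeasurable hV μ).mono_measure (Measure.restrict_mono hKV le_rfl)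
      exact (continuous_abs.measurable.comp_aemeasurable (h.sub hf.aemeasurable)).ennreal_ofReal
    dsimp only
    rw [← lintegral_add_left' hm]
    refine lintegral_mono fun x => ?_
    rw [← ENNReal.ofReal_add (abs_nonneg _) (abs_nonneg _)]
    refine ENNReal.ofReal_le_ofReal ?_
    rw [add_sub_add_comm]
    exact abs_add_le _ _
  · calc ∫⁻ x in V, lipConst (fun y => fn n y + gn n y) x ∂μ
        ≤ ∫⁻ x in V, (lipConst (fn n) x + lipConst (gn n) x) ∂μ :=
          lintegral_mono fun x => lipConst_add_le _ _ _
      _ = (∫⁻ x in V, lipConst (fn n) x ∂μ) + ∫⁻ x in V, lipConst (gn n) x ∂μ :=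
          lintegral_add_left' ((hfl n).aemeasurable_lipConst hV μ) _
      _ ≤ (tvOpen μ f V + ε / 2) + (tvOpen μ g V + ε / 2) := add_le_add (hfa n).le (hga n).le
      _ = tvOpen μ f V + tvOpen μ g V + (ε / 2 + ε / 2) := by ring
      _ = tvOpen μ f V + tvOpen μ g V + ε := by rw [ENNReal.add_halves]

/-- The variation of a function equal to `1` near a compact ball is carried by the complement of a
smaller ball. -/
theorem tvOpen_univ_le_compl_closedBall [BorelSpace X] [ProperSpace X] {μ : Measure X} {f : X → ℝ}
    {x : X} {r : ℝ} (hr : 0 < r) (hf : ∀ y ∈ closedBall x (3 * r), f y = 1) :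
    tvOpen μ f univ ≤ tvOpen μ f (closedBall x r)ᶜ := by
  set V := (closedBall x r)ᶜ
  have hV : IsOpen V := isClosed_closedBall.isOpen_compl
  obtain ⟨C, φ, hφ, h0, h1, hin, hout⟩ :=
    exists_radial_cutoff x (show 2 * r < 3 * r by linarith)
  refine le_of_forall_gt fun a ha => ?_
  obtain ⟨b, hb, hba⟩ := exists_between ha
  refine lt_of_le_of_lt ?_ hba
  obtain ⟨un, hul, hut, hua⟩ := exists_seq_of_tvOpen_lt hb
  set A := (ball x (2 * r))ᶜ
  have hAcl : IsClosed A := isOpen_ball.isClosed_compl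
  have hAV : A ⊆ V := compl_subset_compl.2 (closedBall_subset_ball (by linarith))
  set K := closedBall x (3 * r) ∩ A
  have hK : IsCompact K := (isCompact_closedBall x (3 * r)).inter_right hAcl
  have hKV : K ⊆ V := inter_subset_right.trans hAV
  set w : ℕ → X → ℝ := fun n y => 1 + φ y * (un n y - 1) with hw
  have hwl : ∀ n, LocLipOn univ (w n) := fun n =>
    (locLipOn_const univ 1).add (LocLipOn.cutoff_mul (V := V) (W := ball x (2 * r))
      (u := fun y => un n y - 1) ((hul n).add (locLipOn_const V (-1))) hV isOpen_ball
      (fun y => by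
        by_cases hy : y ∈ ball x (2 * r)
        · exact Or.inr hy
        · exact Or.inl (hAV hy)) hφ h0 h1 (fun y hy => hin y (mem_ball.1 hy).le))
  have hwt : TendstoL1loc μ univ w f := fun L hL _ => by
    refine tendsto_of_tendsto_of_tendsto_of_le_of_le tendsto_const_nhds
      (hut (A ∩ L) (hL.inter_left hAcl) (inter_subset_left.trans hAV)) (fun n => zero_le)
      (fun n => ?_)
    dsimp only
    rw [← setLIntegral_indicator hAcl.measurableSet]
    refine lintegral_mono fun y => ?_
    by_cases hy : y ∈ ball x (2 * r)
    · have hfy : f y = 1 := hf y (mem_closedBall.2 (by linarith [mem_ball.1 hy]))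
      simp [hw, hin y (mem_ball.1 hy).le, hfy]
    · rw [indicator_of_mem (show y ∈ A from hy)]
      refine ENNReal.ofReal_le_ofReal ?_
      by_cases hy3 : y ∈ closedBall x (3 * r)
      · have e : w n y - f y = φ y * (un n y - f y) := by simp only [hw, hf y hy3]; ring
        rw [e, abs_mul, abs_of_nonneg (h0 y)]
        exact mul_le_of_le_one_left (abs_nonneg _) (h1 y)
      · have e : w n y - f y = un n y - f y := by
          simp only [hw, hout y (not_le.1 hy3).le]; ring
        rw [e]
  have hwa : ∀ n, ∫⁻ y, lipConst (w n) y ∂μ ≤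
      b + C * ∫⁻ y in K, ENNReal.ofReal |un n y - f y| ∂μ := fun n => by
    have hpt : ∀ y, lipConst (w n) y ≤ V.indicator (lipConst (un n)) y +
        K.indicator (fun y => C * ENNReal.ofReal |un n y - 1|) y := fun y => by
      by_cases hy : y ∈ ball x (2 * r)
      · have : w n =ᶠ[𝓝 y] fun _ => 1 := by
          filter_upwards [isOpen_ball.mem_nhds hy] with z hz
          simp [hw, hin z (mem_ball.1 hz).le]
        rw [lipConst_congr this, lipConst_const]
        exact zero_le
      · rw [indicator_of_mem (hAV hy)]
        by_cases hy3 : y ∈ closedBall x (3 * r)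
        · rw [indicator_of_mem (show y ∈ K from ⟨hy3, hy⟩)]
          exact lipConst_const_add_mul_le hφ h0 h1 y
        · have : w n =ᶠ[𝓝 y] un n := by
            filter_upwards [isClosed_closedBall.isOpen_compl.mem_nhds hy3] with z hz
            simp [hw, hout z (not_le.1 (mt mem_closedBall.2 hz)).le]
          rw [lipConst_congr this]
          exact le_self_add
    have hKm : MeasurableSet K := hK.isClosed.measurableSet
    have hm : AEMeasurable (fun y => ENNReal.ofReal |un n y - 1|) (μ.restrict K) := by
      have h := ((hul n).aemeasurable hV μ).mono_measure (Measure.restrict_mono hKV le_rfl)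
      exact (continuous_abs.measurable.comp_aemeasurable (h.sub_const 1)).ennreal_ofReal
    refine (lintegral_mono hpt).trans ?_
    rw [lintegral_add_right' _ ((aemeasurable_indicator_iff hKm).2 (hm.const_mul _)),
      lintegral_indicator hV.measurableSet, lintegral_indicator hKm,
      lintegral_const_mul'' _ hm]
    refine add_le_add (hua n).le (le_of_eq ?_)
    congr 1
    exact setLIntegral_congr_fun hKm fun y hy => by rw [hf y hy.1]
  refine (sInf_le ⟨w, hwl, hwt, rfl⟩ : tvOpen μ f univ ≤ _).trans ?_
  have hlim : Tendsto (fun n => b + C * ∫⁻ y in K, ENNReal.ofReal |un n y - f y| ∂μ) atTop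
      (𝓝 (b + C * 0)) :=
    tendsto_const_nhds.add (ENNReal.Tendsto.const_mul (hut K hK hKV) (Or.inr ENNReal.coe_ne_top))
  rw [mul_zero, add_zero] at hlim
  rw [← hlim.liminf_eq]
  refine liminf_le_liminf (Eventually.of_forall fun n => ?_)
  rw [Measure.restrict_univ]
  exact hwa n

end TotalVariation

section Doubling

variable {X : Type*} [MetricSpace X] [MeasurableSpace X] {μ : Measure X} {CD : ℝ≥0}

theorem Doubling.measure_ball_le_pow (h : Doubling μ CD) (x : X) {r : ℝ} (hr : 0 < r) (n : ℕ) :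
    μ (ball x (2 ^ n * r)) ≤ (CD : ℝ≥0∞) ^ n * μ (ball x r) := by
  induction n with
  | zero => simp
  | succ n ih =>
    calc μ (ball x (2 ^ (n + 1) * r)) = μ (ball x (2 * (2 ^ n * r))) := by congr 2; ring
      _ ≤ CD * μ (ball x (2 ^ n * r)) := h.2 _ _ (by positivity)
      _ ≤ CD * ((CD : ℝ≥0∞) ^ n * μ (ball x r)) := by gcongr
      _ = (CD : ℝ≥0∞) ^ (n + 1) * μ (ball x r) := by ring

theorem Doubling.measure_ball_le (h : Doubling μ CD) {r : ℝ} (hr : 0 < r) (R : ℝ) :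
    ∃ n : ℕ, ∀ x : X, μ (ball x R) ≤ (CD : ℝ≥0∞) ^ n * μ (ball x r) := by
  obtain ⟨n, hn⟩ := pow_unbounded_of_one_lt (R / r) (one_lt_two (α := ℝ))
  exact ⟨n, fun x => (measure_mono (ball_subset_ball ((div_lt_iff₀ hr).1 hn).le)).trans
    (h.measure_ball_le_pow x hr n)⟩

theorem Doubling.measure_ball_pos (h : Doubling μ CD) (hμ : μ ≠ 0) (x : X) {r : ℝ}
    (hr : 0 < r) : 0 < μ (ball x r) := by
  refine pos_iff_ne_zero.2 fun h0 => hμ ?_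
  rw [← Measure.measure_univ_eq_zero, ← iUnion_ball_nat x]
  refine measure_iUnion_null fun k => ?_
  obtain ⟨n, hn⟩ := h.measure_ball_le hr k
  simpa [h0] using hn x

theorem Doubling.measure_ball_lt_top [IsLocallyFiniteMeasure μ] (h : Doubling μ CD) (x : X)
    (R : ℝ) : μ (ball x R) < ⊤ := by
  obtain ⟨s, hs, hfin⟩ := μ.finiteAt_nhds x
  obtain ⟨r, hr, hrs⟩ := Metric.mem_nhds_iff.1 hs
  obtain ⟨n, hn⟩ := h.measure_ball_le hr R
  exact (hn x).trans_lt (ENNReal.mul_lt_top (ENNReal.pow_lt_top ENNReal.coe_lt_top)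
    ((measure_mono hrs).trans_lt hfin))

/-- A complete metric space carrying a nonzero locally finite doubling measure is proper. -/
theorem Doubling.properSpace [BorelSpace X] [CompleteSpace X] [IsLocallyFiniteMeasure μ]
    (h : Doubling μ CD) (hμ : μ ≠ 0) : ProperSpace X := by
  refine ⟨fun x R => TotallyBounded.isCompact_of_isClosed ?_ isClosed_closedBall⟩
  rw [Metric.totallyBounded_iff]
  intro ε hε
  obtain ⟨u, hut, hdisj, hcov⟩ := Vitali.exists_disjoint_subfamily_covering_enlargement_closedBall
    (closedBall x R) id (fun _ => ε / 5) (ε / 5) (fun _ _ => le_rfl) 4 (by norm_num)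
  obtain ⟨n, hn⟩ := h.measure_ball_le (show 0 < ε / 5 by positivity) (R + 1)
  set c : ℝ≥0∞ := μ (ball x 1) / (CD : ℝ≥0∞) ^ n
  have hcpos : 0 < c := ENNReal.div_pos (h.measure_ball_pos hμ x one_pos).ne'
    (ENNReal.pow_ne_top ENNReal.coe_ne_top)
  have hle : ∀ y ∈ closedBall x R, c ≤ μ (closedBall y (ε / 5)) := fun y hy => by
    refine ENNReal.div_le_of_le_mul' ?_
    refine (measure_mono (ball_subset_ball' ?_)).trans ((hn y).trans
      (mul_le_mul_right (measure_mono ball_subset_closedBall) _))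
    rw [dist_comm]
    linarith [mem_closedBall.1 hy]
  have hfin : u.Finite := by
    have := Measure.finite_const_le_meas_of_disjoint_iUnion μ hcpos
      (As := fun y : u => closedBall (y : X) (ε / 5)) (fun _ => isClosed_closedBall.measurableSet)
      (fun a b hab => hdisj a.2 b.2 (fun e => hab (Subtype.ext e)))
      (ne_top_of_le_ne_top (h.measure_ball_lt_top x (R + ε)).ne (measure_mono
        (iUnion_subset fun y => closedBall_subset_ball' (by
          linarith [mem_closedBall.1 (hut y.2)]))))
    rw [show {i : u | c ≤ μ (closedBall (i : X) (ε / 5))} = univ from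
      eq_univ_of_forall fun y => hle y (hut y.2)] at this
    exact Set.finite_coe_iff.1 (Set.finite_univ_iff.1 this)
  refine ⟨u, hfin, fun y hy => ?_⟩
  obtain ⟨z, hz, hyz⟩ := hcov y hy
  refine mem_iUnion₂.2 ⟨z, hz, ?_⟩
  have := mem_closedBall.1 (hyz (mem_closedBall_self (by positivity)))
  simp only [id] at this
  exact mem_ball.2 (by linarith)

end Doubling

section PerimeterInBalls

variable {X : Type*} [MetricSpace X] [MeasurableSpace X] {μ : Measure X}

theorem isOpen_setOf_locally_null (μ : Measure X) (S : Set X) :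
    IsOpen {x | ∃ s > 0, μ (ball x s ∩ S) = 0} := by
  rw [Metric.isOpen_iff]
  rintro x ⟨s, hs, h⟩
  refine ⟨s, hs, fun y hy => ⟨s - dist y x, sub_pos.2 (mem_ball.1 hy), measure_mono_null
    (inter_subset_inter_left S (ball_subset_ball' (by linarith))) h⟩⟩

theorem measure_inter_eq_zero_of_locally_null [TopologicalSpace.SeparableSpace X] {S T : Set X}
    (h : ∀ x ∈ T, ∃ s > 0, μ (ball x s ∩ S) = 0) : μ (T ∩ S) = 0 := by
  have : SecondCountableTopology X := UniformSpace.secondCountable_of_separable X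
  refine measure_null_of_locally_null _ fun x hx => ?_
  obtain ⟨s, hs, h0⟩ := h x hx.1
  refine ⟨ball x s ∩ S, ?_, h0⟩
  exact inter_mem (mem_nhdsWithin_of_mem_nhds (ball_mem_nhds x hs))
    (mem_of_superset self_mem_nhdsWithin inter_subset_right)

variable [BorelSpace X]

/-- If the perimeter of `F` vanishes in a ball, then `F` is null or conull in a smaller ball. -/
theorem WeakPoincare.null_or_conull [ProperSpace X] {CP lam : ℝ} (hlam : 1 ≤ lam)
    (hP : WeakPoincare μ CP lam) {F : Set X} (hF : MeasurableSet F) {x : X} {R : ℝ} (hR : 0 < R)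
    (h0 : tvOpen μ (F.indicator fun _ => (1 : ℝ)) (ball x R) = 0) :
    ∃ s > 0, μ (ball x s ∩ F) = 0 ∨ μ (ball x s ∩ Fᶜ) = 0 := by
  have hlam0 : 0 < lam := one_pos.trans_le hlam
  set s := R / (4 * lam) with hs
  have hs0 : 0 < s := by positivity
  have hls : lam * s = R / 4 := by rw [hs]; field_simp
  have hsR : s ≤ R / 4 := by nlinarith
  refine ⟨s, hs0, ?_⟩
  set f : X → ℝ := F.indicator fun _ => (1 : ℝ) with hf
  have hfm : Measurable f := measurable_const.indicator hF
  set B := ball x s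
  set m := min (μ (B ∩ F)) (μ (B ∩ Fᶜ))
  suffices hm0 : m = 0 by
    rcases min_choice (μ (B ∩ F)) (μ (B ∩ Fᶜ)) with h | h
    · exact Or.inl (h ▸ hm0)
    · exact Or.inr (h ▸ hm0)
  obtain ⟨C, φ, hφ, hφ0, hφ1, hin, hout⟩ :=
    exists_radial_cutoff x (show R / 4 < R / 2 by linarith)
  have hψ : LipschitzWith C (fun y => 1 - φ y) := by
    simpa using (LipschitzWith.const (1 : ℝ)).sub hφ
  -- a lower bound for the distance of `1_F` from constants
  have hlow : ∀ c : ℝ, m ≤ ∫⁻ y in B, ENNReal.ofReal |f y - c| ∂μ := fun c => by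
    have h1 : (1 : ℝ≥0∞) ≤ ENNReal.ofReal |1 - c| + ENNReal.ofReal |0 - c| := by
      rw [← ENNReal.ofReal_add (abs_nonneg _) (abs_nonneg _), ← ENNReal.ofReal_one]
      refine ENNReal.ofReal_le_ofReal ?_
      have := abs_sub (1 - c) (0 - c)
      have e : (1 - c) - (0 - c) = 1 := by ring
      rw [e, abs_one] at this
      exact this
    have hBF : ∫⁻ y in B ∩ F, ENNReal.ofReal |f y - c| ∂μ = ENNReal.ofReal |1 - c| * μ (B ∩ F) := by
      rw [← setLIntegral_const]
      exact setLIntegral_congr_fun (isOpen_ball.measurableSet.inter hF) fun y hy => by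
        simp [hf, hy.2]
    have hBG : ∫⁻ y in B ∩ Fᶜ, ENNReal.ofReal |f y - c| ∂μ =
        ENNReal.ofReal |0 - c| * μ (B ∩ Fᶜ) := by
      rw [← setLIntegral_const]
      exact setLIntegral_congr_fun (isOpen_ball.measurableSet.inter hF.compl) fun y hy => by
        have : y ∉ F := hy.2
        simp [hf, this]
    have hsplit := lintegral_union (μ := μ) (f := fun y => ENNReal.ofReal |f y - c|)
      (isOpen_ball.measurableSet.inter hF.compl : MeasurableSet (B ∩ Fᶜ))
      (disjoint_compl_right.mono inter_subset_right inter_subset_right : Disjoint (B ∩ F) (B ∩ Fᶜ))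
    rw [inter_union_compl, hBF, hBG] at hsplit
    rw [hsplit]
    calc m = 1 * m := (one_mul m).symm
      _ ≤ (ENNReal.ofReal |1 - c| + ENNReal.ofReal |0 - c|) * m := by gcongr
      _ = ENNReal.ofReal |1 - c| * m + ENNReal.ofReal |0 - c| * m := add_mul _ _ _
      _ ≤ _ := add_le_add (mul_le_mul_right (min_le_left _ _) _)
        (mul_le_mul_right (min_le_right _ _) _)
  have hBc : closedBall x s ⊆ ball x R := closedBall_subset_ball (by linarith)
  have key : ∀ δ : ℝ≥0∞, 0 < δ → m ≤ ENNReal.ofReal (CP * s) * δ := fun δ hδ => by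
    obtain ⟨fn, hl, ht, ha⟩ := exists_seq_of_tvOpen_lt (h0.trans_lt hδ)
    have hlim := (tendsto_const_nhds (x := ENNReal.ofReal (CP * s) * δ)).add
      (ht _ (isCompact_closedBall x s) hBc)
    rw [add_zero] at hlim
    refine ge_of_tendsto' hlim fun n => ?_
    set g : X → ℝ := fun y => (1 - φ y) * fn n y with hg
    have hgl : LocLipOn univ g := LocLipOn.cutoff_mul (V := ball x R) (W := (closedBall x (R / 2))ᶜ)
      (hl n) isOpen_ball isClosed_closedBall.isOpen_compl
      (fun y => by
        by_cases hy : y ∈ closedBall x (R / 2)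
        · exact Or.inl (closedBall_subset_ball (by linarith) hy)
        · exact Or.inr hy) hψ (fun y => by linarith [hφ1 y]) (fun y => by linarith [hφ0 y])
      (fun y hy => by rw [hout y (not_le.1 (mt mem_closedBall.2 hy)).le, sub_self])
    have hgf : ∀ y ∈ ball x (R / 4), g y = fn n y := fun y hy => by
      simp [hg, hin y (mem_ball.1 hy).le]
    have hpoin := hP g hgl x s hs0
    rw [hls] at hpoin
    have hen : ∫⁻ y in ball x (R / 4), lipConst g y ∂μ ≤ δ := by
      calc ∫⁻ y in ball x (R / 4), lipConst g y ∂μ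
          = ∫⁻ y in ball x (R / 4), lipConst (fn n) y ∂μ :=
            setLIntegral_congr_fun isOpen_ball.measurableSet fun y hy =>
              lipConst_congr (by filter_upwards [isOpen_ball.mem_nhds hy] with z hz using hgf z hz)
        _ ≤ ∫⁻ y in ball x R, lipConst (fn n) y ∂μ :=
            lintegral_mono_set (ball_subset_ball (by linarith))
        _ ≤ δ := (ha n).le
    have hmeas : AEMeasurable (fun y => ENNReal.ofReal |fn n y - f y|) (μ.restrict B) := by
      have h := ((hl n).aemeasurable isOpen_ball μ).mono_measure
        (Measure.restrict_mono (ball_subset_closedBall.trans hBc) le_rfl)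
      exact (continuous_abs.measurable.comp_aemeasurable (h.sub hfm.aemeasurable)).ennreal_ofReal
    set c := ballAvg μ g x s
    calc m ≤ ∫⁻ y in B, ENNReal.ofReal |f y - c| ∂μ := hlow c
      _ ≤ ∫⁻ y in B, (ENNReal.ofReal |g y - c| + ENNReal.ofReal |fn n y - f y|) ∂μ := by
          refine setLIntegral_mono' isOpen_ball.measurableSet fun y hy => ?_
          rw [← ENNReal.ofReal_add (abs_nonneg _) (abs_nonneg _),
            hgf y (ball_subset_ball hsR hy)]
          refine ENNReal.ofReal_le_ofReal ?_
          have e : f y - c = (fn n y - c) - (fn n y - f y) := by ring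
          rw [e]
          exact abs_sub _ _
      _ = (∫⁻ y in B, ENNReal.ofReal |g y - c| ∂μ) +
          ∫⁻ y in B, ENNReal.ofReal |fn n y - f y| ∂μ := lintegral_add_right' _ hmeas
      _ ≤ ENNReal.ofReal (CP * s) * δ +
          ∫⁻ y in closedBall x s, ENNReal.ofReal |fn n y - f y| ∂μ :=
          add_le_add (hpoin.trans (mul_le_mul_right hen _))
            (lintegral_mono_set ball_subset_closedBall)
  have hlim : Tendsto (fun δ : ℝ≥0∞ => ENNReal.ofReal (CP * s) * δ) (𝓝[>] 0) (𝓝 0) := by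
    have := (ENNReal.continuous_const_mul (a := ENNReal.ofReal (CP * s))
      ENNReal.ofReal_ne_top).tendsto 0
    rw [mul_zero] at this
    exact this.mono_left nhdsWithin_le_nhds
  refine le_antisymm (ge_of_tendsto hlim ?_) zero_le
  filter_upwards [self_mem_nhdsWithin] with δ hδ using key δ hδ

/-- If the perimeter of `Ω = F ∪ G` splits additively, then `F` has no perimeter locally in the
interior of `Ω`. -/
theorem tvOpen_ball_eq_zero_of_perim_additive [ProperSpace X] {Ω F G : Set X}
    (hF : FinPerim μ F) (hG : FinPerim μ G) (hFG : Disjoint F G) (hΩ : F ∪ G = Ω)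
    (hadd : perim μ Ω univ = perim μ F univ + perim μ G univ) {x : X} {r : ℝ} (hr : 0 < r)
    (hball : closedBall x (3 * r) ⊆ Ω) :
    tvOpen μ (F.indicator fun _ => (1 : ℝ)) (ball x r) = 0 := by
  have hFfin := hF.2
  have hGfin := hG.2
  simp only [perim, tv_univ] at hadd hFfin hGfin
  set f : X → ℝ := F.indicator fun _ => (1 : ℝ) with hf
  set g : X → ℝ := G.indicator fun _ => (1 : ℝ) with hg
  set V := (closedBall x r)ᶜ
  have hV : IsOpen V := isClosed_closedBall.isOpen_compl
  have hUV : Disjoint (ball x r) V := disjoint_compl_right.mono_left ball_subset_closedBall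
  have hsum : Ω.indicator (fun _ => (1 : ℝ)) = fun y => f y + g y := by
    rw [← hΩ, indicator_union_of_disjoint hFG]
  have h1 : tvOpen μ (Ω.indicator fun _ => (1 : ℝ)) univ ≤ tvOpen μ f V + tvOpen μ g V := by
    refine (tvOpen_univ_le_compl_closedBall hr fun y hy => indicator_of_mem (hball hy) _).trans ?_
    rw [hsum]
    exact tvOpen_add_le (measurable_const.indicator hF.1) hV
  have hFs := tvOpen_add_tvOpen_le (μ := μ) (f := f) hV hUV
  have hGs := tvOpen_add_tvOpen_le (μ := μ) (f := g) hV hUV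
  have hVf : tvOpen μ f V ≠ ⊤ := ne_top_of_le_ne_top hFfin.ne (le_add_self.trans hFs)
  have hVg : tvOpen μ g V ≠ ⊤ := ne_top_of_le_ne_top hGfin.ne (le_add_self.trans hGs)
  have htot : tvOpen μ f (ball x r) + (tvOpen μ f V + tvOpen μ g V) ≤
      0 + (tvOpen μ f V + tvOpen μ g V) := by
    rw [zero_add, ← add_assoc]
    exact (add_le_add hFs (le_add_self.trans hGs)).trans (hadd ▸ h1)
  exact le_antisymm ((ENNReal.add_le_add_iff_right (ENNReal.add_ne_top.2 ⟨hVf, hVg⟩)).1 htot)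
    zero_le

end PerimeterInBalls

variable {X : Type*} [MetricSpace X] [CompleteSpace X] [TopologicalSpace.SeparableSpace X]
  [MeasurableSpace X] [BorelSpace X]

/-- Open connected sets of finite perimeter are indecomposable. -/
theorem open_connected_indecomposable
    (μ : Measure X) [IsLocallyFiniteMeasure μ] (hμ : μ ≠ 0) (hPI : IsPI μ)
    (Ω : Set X) (hopen : IsOpen Ω) (hconn : IsConnected Ω) (hper : FinPerim μ Ω) :
    Indecomposable μ Ω := by
  refine ⟨hper, ?_⟩
  rintro ⟨F, G, hF, hG, hFG, hunion, hF0, hG0, hadd⟩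
  rw [inter_univ] at hunion
  obtain ⟨CD, CP, lam, hD, -, hlam, hP⟩ := hPI
  have : ProperSpace X := hD.properSpace hμ
  have hloc : ∀ x ∈ Ω, ∃ s > 0, μ (ball x s ∩ F) = 0 ∨ μ (ball x s ∩ Fᶜ) = 0 := fun x hx => by
    obtain ⟨ε, hε, hεΩ⟩ := Metric.isOpen_iff.1 hopen x hx
    have hr : 0 < ε / 4 := by positivity
    exact hP.null_or_conull hlam hF.1 hr (tvOpen_ball_eq_zero_of_perim_additive hF hG hFG hunion
      hadd hr ((closedBall_subset_ball (by linarith)).trans hεΩ))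
  set A := {x | ∃ s > 0, μ (ball x s ∩ F) = 0}
  set B := {x | ∃ s > 0, μ (ball x s ∩ Fᶜ) = 0}
  have hcover : Ω ⊆ A ∪ B := fun x hx => by
    obtain ⟨s, hs, h | h⟩ := hloc x hx
    · exact Or.inl ⟨s, hs, h⟩
    · exact Or.inr ⟨s, hs, h⟩
  have hdisj : Disjoint A B := by
    rw [Set.disjoint_left]
    rintro x ⟨s, hs, h⟩ ⟨t, ht, h'⟩
    refine (hD.measure_ball_pos hμ x (lt_min hs ht)).ne' ?_
    rw [← inter_union_compl (ball x (min s t)) F]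
    exact measure_union_null
      (measure_mono_null (inter_subset_inter_left _ (ball_subset_ball (min_le_left _ _))) h)
      (measure_mono_null (inter_subset_inter_left _ (ball_subset_ball (min_le_right _ _))) h')
  have hAo : IsOpen A := isOpen_setOf_locally_null μ F
  have hBo : IsOpen B := isOpen_setOf_locally_null μ Fᶜ
  obtain ⟨x, hx⟩ := hconn.nonempty
  rcases hcover hx with hxA | hxB
  · have hΩA : Ω ⊆ A := IsPreconnected.subset_left_of_subset_union hAo hBo hdisj hcover
      ⟨x, hx, hxA⟩ hconn.isPreconnected
    refine hF0.ne' (measure_mono_null ?_ (measure_inter_eq_zero_of_locally_null hΩA))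
    exact subset_inter (hunion ▸ subset_union_left) Subset.rfl
  · have hΩB : Ω ⊆ B := IsPreconnected.subset_right_of_subset_union hAo hBo hdisj hcover
      ⟨x, hx, hxB⟩ hconn.isPreconnected
    refine hG0.ne' (measure_mono_null ?_ (measure_inter_eq_zero_of_locally_null hΩB))
    exact subset_inter (hunion ▸ subset_union_right) (subset_compl_iff_disjoint_left.2 hFG)

end PaperBV
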